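/- There is no adequate uniform construction for the monotone neighborhood functor M. Precisely: there is no uniform construction F for M (assigning to each pair (X, α ∈ M X) a set X_*, an element α_* ∈ M X_*, and a map h_α : X_* → X with M(h_α)(α_*) = α) such that for all sets X, Y, every map f : X → Y, all α ∈ M X and β ∈ M Y with M f(α) = β, and every subset S ⊆ Y: (f ∘ h_α)⁻¹[S] = ∅ if and only if (h_β)⁻¹[S] = ∅. (This condition is the adequacy requirement (★) instantiated at the quantifier-depth-one one-step second-order sentence ∀Z.(a ⊆ Z), which holds in a one-step model exactly when the variable a has empty extension.) -/

import Mathlib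

/-- The monotone neighborhood functor on objects: upward-closed collections of subsets. -/
def MObj (X : Type) : Type :=
  {N : Set (Set X) // ∀ Z Z' : Set X, Z ∈ N → Z ⊆ Z' → Z' ∈ N}

/-- The action of the monotone neighborhood functor on maps:
`M f (N) = {Z ⊆ Y | f⁻¹[Z] ∈ N}`. -/
def MMap {X Y : Type} (f : X → Y) (N : MObj X) : MObj Y :=
  ⟨{Z : Set Y | f ⁻¹' Z ∈ N.1}, fun Z Z' hZ hsub => N.2 _ _ hZ (Set.preimage_mono hsub)⟩

/-- The neighborhood family of all sets of natural numbers that contain a final segment. -/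
def eventualNat : MObj ℕ :=
  ⟨(Filter.atTop : Filter ℕ).sets, fun _ _ hZ hsub => Filter.mem_of_superset hZ hsub⟩

theorem MMap_add_eventualNat (k : ℕ) : MMap (fun n : ℕ => n + k) eventualNat = eventualNat :=
  Subtype.ext (congrArg Filter.sets (Filter.map_add_atTop_eq_nat k))

/-- There is no adequate uniform construction for the monotone
neighborhood functor `M`: no uniform construction `(X, α) ↦ (X_*, α_*, h_α)` for `M`
satisfies the adequacy requirement `(★)` for the quantifier-depth-one sentence
`∀Z.(a ⊆ Z)` (which expresses that the variable `a` has empty extension). -/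
theorem no_adequate_uniform_construction_for_M :
    ¬ ∃ (star : (X : Type) → MObj X → Type)
        (el : (X : Type) → (α : MObj X) → MObj (star X α))
        (h : (X : Type) → (α : MObj X) → star X α → X),
        (∀ (X : Type) (α : MObj X), MMap (h X α) (el X α) = α) ∧
        (∀ (X Y : Type) (f : X → Y) (α : MObj X) (β : MObj Y), MMap f α = β →
          ∀ S : Set Y, ((f ∘ h X α) ⁻¹' S = ∅ ↔ (h Y β) ⁻¹' S = ∅)) := by
  rintro ⟨star, el, h, hel, had⟩
  have hne (n : ℕ) : h ℕ eventualNat ⁻¹' {n} = ∅ := by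
    refine (had ℕ ℕ _ _ _ (MMap_add_eventualNat (n + 1)) {n}).1 ?_
    refine Set.eq_empty_of_forall_notMem fun x (hx : h ℕ eventualNat x + (n + 1) = n) => ?_
    omega
  have : IsEmpty (star ℕ eventualNat) :=
    ⟨fun x => (hne (h ℕ eventualNat x)).subset (Set.mem_singleton (h ℕ eventualNat x))⟩
  have hmem (Z : Set ℕ) : h ℕ eventualNat ⁻¹' Z ∈ (el ℕ eventualNat).1 ↔
      Z ∈ (Filter.atTop : Filter ℕ) :=
    Set.ext_iff.1 (congrArg Subtype.val (hel ℕ eventualNat)) Z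
  have huniv := (hmem Set.univ).2 Filter.univ_mem
  rw [Subsingleton.elim (h ℕ eventualNat ⁻¹' Set.univ) (h ℕ eventualNat ⁻¹' ∅), hmem] at huniv
  exact Filter.empty_notMem _ huniv
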